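/- (Gluing lemma.) Suppose PG_{d-1}(4) admits a legal truncation removing n₁ points in which some hyperplane is untouched, and also a legal truncation removing n₂ points in which some hyperplane is untouched. Then PG_d(4) admits a legal truncation removing n₁+n₂ points. Moreover, if PG_{d-1}(4) admits legal truncations removing n₁ and n₂ points, each leaving some hyperplane whose removed points form exactly the point set of a copy of PG_i(4), then PG_d(4) admits a legal truncation removing n₁+n₂-[i]₄ points. -/

import Mathlib

/-- The field with four elements. -/
abbrev F4 : Type := GaloisField 2 2

/-- The points of the projective space `PG_d(4)` : one-dimensional subspaces of `F4^(d+1)`. -/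
abbrev PGPoint (d : ℕ) := Projectivization F4 (Fin (d + 1) → F4)

/-- The set of projective points lying in a given linear subspace `W` of `F4^(d+1)`. -/
def pointsIn {d : ℕ} (W : Submodule F4 (Fin (d + 1) → F4)) : Set (PGPoint d) :=
  {p | p.submodule ≤ W}

/-- A line of `PG_d(4)` : the set of points contained in some 2-dimensional linear subspace. -/
def IsLine {d : ℕ} (L : Set (PGPoint d)) : Prop :=
  ∃ W : Submodule F4 (Fin (d + 1) → F4), Module.finrank F4 W = 2 ∧ L = pointsIn W

/-- `LegalTrunc D` : removing the point set `D` from `PG_d(4)` is a legal truncation,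
i.e. no line has exactly two points outside `D`. -/
def LegalTrunc {d : ℕ} (D : Set (PGPoint d)) : Prop :=
  ∀ L : Set (PGPoint d), IsLine L → (L \ D).ncard ≠ 2

/-- `bracket4 e = [e]₄ = 1 + 4 + 4² + ⋯ + 4^e`. -/
def bracket4 (e : ℕ) : ℕ := ∑ i ∈ Finset.range (e + 1), 4 ^ i

/-- `TT d i` (the set `T(d,i)` of the paper): the set of integers `n` such that `PG_d(4)`
admits a legal truncation removing `n` points, in which some hyperplane `H` has
removed-point set exactly the point set of a copy of `PG_i(4)` contained in `H`. -/
def TT (d i : ℕ) : Set ℕ :=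
  {n | ∃ D : Set (PGPoint d), LegalTrunc D ∧ D.ncard = n ∧
    ∃ H W : Submodule F4 (Fin (d + 1) → F4),
      Module.finrank F4 H = d ∧ Module.finrank F4 W = i + 1 ∧ W ≤ H ∧
        D ∩ pointsIn H = pointsIn W}

/-- `SS d i = S(d,i) = T(d,i) - [i]₄` (every element of `T(d,i)` is at least `[i]₄`). -/
def SS (d i : ℕ) : Set ℕ := {m | m + bracket4 i ∈ TT d i}

open Module

theorem mk_mem_pointsIn {d : ℕ} {W : Submodule F4 (Fin (d + 1) → F4)}
    {v : Fin (d + 1) → F4} (hv : v ≠ 0) :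
    (Projectivization.mk F4 v hv : PGPoint d) ∈ pointsIn W ↔ v ∈ W := by
  simp [pointsIn, Submodule.span_singleton_le_iff_mem]

theorem map_mem_pointsIn {d e : ℕ} {f : (Fin (d + 1) → F4) →ₗ[F4] (Fin (e + 1) → F4)}
    (hf : Function.Injective f) {U : Submodule F4 (Fin (e + 1) → F4)} {p : PGPoint d} :
    p.map f hf ∈ pointsIn U ↔ p ∈ pointsIn (U.comap f) := by
  induction p using Projectivization.ind with | h v hv =>
  rw [Projectivization.map_mk, mk_mem_pointsIn, mk_mem_pointsIn, Submodule.mem_comap]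

theorem pointsIn_inf {d : ℕ} (U W : Submodule F4 (Fin (d + 1) → F4)) :
    pointsIn (U ⊓ W) = pointsIn U ∩ pointsIn W := by
  ext p
  simp [pointsIn]

theorem pointsIn_bot {d : ℕ} : pointsIn (⊥ : Submodule F4 (Fin (d + 1) → F4)) = ∅ := by
  ext p
  induction p using Projectivization.ind with | h v hv => simp [mk_mem_pointsIn, hv]

theorem image_map_pointsIn {d e : ℕ} {f : (Fin (d + 1) → F4) →ₗ[F4] (Fin (e + 1) → F4)}
    (hf : Function.Injective f) (W : Submodule F4 (Fin (d + 1) → F4)) :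
    Projectivization.map f hf '' pointsIn W = pointsIn (W.map f) := by
  ext p
  constructor
  · rintro ⟨p, hp, rfl⟩
    rwa [map_mem_pointsIn, Submodule.comap_map_eq_of_injective hf]
  · induction p using Projectivization.ind with | h v hv =>
    rw [mk_mem_pointsIn]
    rintro ⟨w, hw, rfl⟩
    have hw0 : w ≠ 0 := by rintro rfl; simp at hv
    exact ⟨Projectivization.mk F4 w hw0, (mk_mem_pointsIn hw0).2 hw, rfl⟩

theorem ncard_pointsIn {d : ℕ} (W : Submodule F4 (Fin (d + 1) → F4)) :
    (pointsIn W).ncard = ∑ i ∈ Finset.range (finrank F4 W), 4 ^ i := by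
  have hcard : Nat.card F4 = 4 := by
    rw [GaloisField.card 2 2 two_ne_zero]
    norm_num
  have hrange : pointsIn W = Set.range (Projectivization.map W.subtype W.injective_subtype) := by
    ext p
    induction p using Projectivization.ind with | h v hv =>
    rw [mk_mem_pointsIn]
    constructor
    · intro h
      exact ⟨Projectivization.mk F4 ⟨v, h⟩ (by simpa using hv), rfl⟩
    · rintro ⟨q, hq⟩
      induction q using Projectivization.ind with | h w hw =>
      rw [Projectivization.map_mk, Projectivization.mk_eq_mk_iff'] at hq
      obtain ⟨a, ha⟩ := hq
      have ha0 : a ≠ 0 := by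
        rintro rfl
        exact hw (Subtype.ext (by simpa using ha.symm))
      exact (W.smul_mem_iff ha0).1 (ha ▸ w.2)
  rw [hrange, ← Nat.card_coe_set_eq,
    Nat.card_range_of_injective (Projectivization.map_injective _ _),
    Projectivization.card_of_finrank F4 W rfl, hcard]

theorem ncard_pointsIn_of_finrank_eq_two {d : ℕ} {U : Submodule F4 (Fin (d + 1) → F4)}
    (hU : finrank F4 U = 2) : (pointsIn U).ncard = 5 := by
  rw [ncard_pointsIn, hU]
  simp [Finset.sum_range_succ]

theorem ncard_pointsIn_inf_le_one {d : ℕ} {U R : Submodule F4 (Fin (d + 1) → F4)}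
    (hU : finrank F4 U = 2) (hUR : ¬ U ≤ R) : (pointsIn U ∩ pointsIn R).ncard ≤ 1 := by
  have hlt := Submodule.finrank_lt_finrank_of_lt (inf_lt_left.2 hUR)
  rw [hU] at hlt
  rw [← pointsIn_inf, ncard_pointsIn]
  refine (Finset.sum_le_sum_of_subset (Finset.range_mono (Nat.le_of_lt_succ hlt))).trans ?_
  simp

theorem image_map_subset_pointsIn_range {d e : ℕ}
    {f : (Fin (d + 1) → F4) →ₗ[F4] (Fin (e + 1) → F4)} (hf : Function.Injective f)
    (D : Set (PGPoint d)) :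
    Projectivization.map f hf '' D ⊆ pointsIn (LinearMap.range f) := by
  rintro _ ⟨p, -, rfl⟩
  rw [map_mem_pointsIn]
  exact fun x _ => ⟨x, rfl⟩

/-- A legal truncation stays legal along every line of an embedded projective space. -/
theorem LegalTrunc.ncard_pointsIn_diff_image_map {d e : ℕ} {D : Set (PGPoint d)}
    (hD : LegalTrunc D) {f : (Fin (d + 1) → F4) →ₗ[F4] (Fin (e + 1) → F4)}
    (hf : Function.Injective f) {U : Submodule F4 (Fin (e + 1) → F4)} (hU : finrank F4 U = 2)
    (hUf : U ≤ LinearMap.range f) :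
    (pointsIn U \ Projectivization.map f hf '' D).ncard ≠ 2 := by
  have hmap : (U.comap f).map f = U := by
    rw [Submodule.map_comap_eq, inf_eq_right.2 hUf]
  have hrank : finrank F4 (U.comap f) = 2 := by
    rw [(Submodule.equivMapOfInjective f hf _).finrank_eq, hmap, hU]
  rw [← hmap, ← image_map_pointsIn hf, ← Set.image_sdiff (Projectivization.map_injective f hf),
    Set.ncard_image_of_injective _ (Projectivization.map_injective f hf)]
  exact hD _ ⟨_, hrank, rfl⟩

/-- Two legal truncations placed in two subspaces glue to a legal truncation when they agree on
the intersection of these subspaces. -/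
theorem LegalTrunc.union_image_map {d e : ℕ} {D₁ D₂ : Set (PGPoint d)} (h₁ : LegalTrunc D₁)
    (h₂ : LegalTrunc D₂) {f g : (Fin (d + 1) → F4) →ₗ[F4] (Fin (e + 1) → F4)}
    (hf : Function.Injective f) (hg : Function.Injective g)
    (h₁₂ : Projectivization.map f hf '' D₁ ∩ pointsIn (LinearMap.range g) =
      Projectivization.map g hg '' D₂ ∩ pointsIn (LinearMap.range f)) :
    LegalTrunc (Projectivization.map f hf '' D₁ ∪ Projectivization.map g hg '' D₂) := by
  have hfD := image_map_subset_pointsIn_range hf D₁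
  have hgD := image_map_subset_pointsIn_range hg D₂
  rintro _ ⟨U, hU, rfl⟩
  set A := Projectivization.map f hf '' D₁
  set B := Projectivization.map g hg '' D₂
  by_cases hUf : U ≤ LinearMap.range f
  · have : pointsIn U \ (A ∪ B) = pointsIn U \ A := by
      ext p
      have hp := Set.ext_iff.1 h₁₂ p
      have hpU : p ∈ pointsIn U → p ∈ pointsIn (LinearMap.range f) := fun h => le_trans h hUf
      simp only [Set.mem_inter_iff] at hp
      simp only [Set.mem_sdiff, Set.mem_union]
      tauto
    rw [this]
    exact h₁.ncard_pointsIn_diff_image_map hf hU hUf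
  by_cases hUg : U ≤ LinearMap.range g
  · have : pointsIn U \ (A ∪ B) = pointsIn U \ B := by
      ext p
      have hp := Set.ext_iff.1 h₁₂ p
      have hpU : p ∈ pointsIn U → p ∈ pointsIn (LinearMap.range g) := fun h => le_trans h hUg
      simp only [Set.mem_inter_iff] at hp
      simp only [Set.mem_sdiff, Set.mem_union]
      tauto
    rw [this]
    exact h₂.ncard_pointsIn_diff_image_map hg hU hUg
  have hsub : pointsIn U ⊆ (pointsIn U \ (A ∪ B)) ∪
      ((pointsIn U ∩ pointsIn (LinearMap.range f)) ∪
        (pointsIn U ∩ pointsIn (LinearMap.range g))) := by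
    intro p hp
    by_cases hpA : p ∈ A
    · exact .inr (.inl ⟨hp, hfD hpA⟩)
    by_cases hpB : p ∈ B
    · exact .inr (.inr ⟨hp, hgD hpB⟩)
    exact .inl ⟨hp, by simp [hpA, hpB]⟩
  have h5 := (Set.ncard_le_ncard hsub (Set.toFinite _)).trans (Set.ncard_union_le _ _)
  have h3 := Set.ncard_union_le (pointsIn U ∩ pointsIn (LinearMap.range f))
    (pointsIn U ∩ pointsIn (LinearMap.range g))
  have hf1 := ncard_pointsIn_inf_le_one hU hUf
  have hg1 := ncard_pointsIn_inf_le_one hU hUg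
  rw [ncard_pointsIn_of_finrank_eq_two hU] at h5
  omega

/-- Flags of subspaces of equal dimensions are related by a linear automorphism. -/
theorem exists_linearEquiv_map_eq_map_eq {K V : Type*} [Field K] [AddCommGroup V] [Module K V]
    [FiniteDimensional K V] {H₁ H₂ W₁ W₂ : Submodule K V} (hW₁ : W₁ ≤ H₁) (hW₂ : W₂ ≤ H₂)
    (hH : finrank K H₁ = finrank K H₂) (hW : finrank K W₁ = finrank K W₂) :
    ∃ φ : V ≃ₗ[K] V, H₁.map φ.toLinearMap = H₂ ∧ W₁.map φ.toLinearMap = W₂ := by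
  let ε := LinearEquiv.ofFinrankEq H₁ H₂ hH
  let P₁ : Submodule K H₂ := (W₁.submoduleOf H₁).map ε.toLinearMap
  have hP : finrank K P₁ = finrank K (W₂.submoduleOf H₂) := by
    rw [LinearEquiv.finrank_map_eq ε, (Submodule.submoduleOfEquivOfLe hW₁).finrank_eq,
      (Submodule.submoduleOfEquivOfLe hW₂).finrank_eq, hW]
  obtain ⟨γ, hγ⟩ := Submodule.exists_linearEquiv_restrict_eq (LinearEquiv.ofFinrankEq _ _ hP)
  obtain ⟨φ, hφ⟩ := Submodule.exists_linearEquiv_restrict_eq (ε ≪≫ₗ γ)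
  have hHφ : H₁.map φ.toLinearMap ≤ H₂ := by
    rintro _ ⟨x, hx, rfl⟩
    have := hφ ⟨x, hx⟩
    exact this ▸ Subtype.property _
  have hWφ : W₁.map φ.toLinearMap ≤ W₂ := by
    rintro _ ⟨x, hx, rfl⟩
    have h1 : ((γ (ε ⟨x, hW₁ hx⟩) : H₂) : V) = φ x := hφ ⟨x, hW₁ hx⟩
    have h2 : ε ⟨x, hW₁ hx⟩ ∈ P₁ := ⟨⟨x, hW₁ hx⟩, hx, rfl⟩
    have h3 := hγ ⟨_, h2⟩
    have h4 : γ (ε ⟨x, hW₁ hx⟩) ∈ W₂.submoduleOf H₂ := h3 ▸ Subtype.property _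
    exact h1 ▸ h4
  exact ⟨φ, Submodule.eq_of_le_of_finrank_eq hHφ (by rw [LinearEquiv.finrank_map_eq, hH]),
    Submodule.eq_of_le_of_finrank_eq hWφ (by rw [LinearEquiv.finrank_map_eq, hW])⟩

theorem exists_ker_eq_of_finrank_add_one_eq {K V : Type*} [Field K] [AddCommGroup V] [Module K V]
    [FiniteDimensional K V] {H : Submodule K V} (hH : finrank K H + 1 = finrank K V) :
    ∃ ℓ : V →ₗ[K] K, LinearMap.ker ℓ = H := by
  have hlt : H < ⊤ := lt_top_iff_ne_top.2 fun h => by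
    rw [h, finrank_top] at hH
    omega
  obtain ⟨ℓ, hℓ, hle⟩ := H.exists_le_ker_of_lt_top hlt
  refine ⟨ℓ, (Submodule.eq_of_le_of_finrank_eq hle ?_).symm⟩
  have := Module.Dual.finrank_ker_add_one_of_ne_zero hℓ
  omega

/-- Gluing two legal truncations along hyperplanes that meet them in subspaces of the same
dimension. -/
theorem exists_legalTrunc_glue {e : ℕ} {D₁ D₂ : Set (PGPoint e)} (h₁ : LegalTrunc D₁)
    (h₂ : LegalTrunc D₂) {H₁ H₂ W₁ W₂ : Submodule F4 (Fin (e + 1) → F4)}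
    (hH₁ : finrank F4 H₁ = e) (hH₂ : finrank F4 H₂ = e) (hW : finrank F4 W₁ = finrank F4 W₂)
    (hW₁ : W₁ ≤ H₁) (hW₂ : W₂ ≤ H₂) (hD₁ : D₁ ∩ pointsIn H₁ = pointsIn W₁)
    (hD₂ : D₂ ∩ pointsIn H₂ = pointsIn W₂) :
    ∃ D : Set (PGPoint (e + 1)), LegalTrunc D ∧
      D.ncard + (pointsIn W₂).ncard = D₁.ncard + D₂.ncard := by
  obtain ⟨φ, hφH, hφW⟩ := exists_linearEquiv_map_eq_map_eq hW₁ hW₂ (hH₁.trans hH₂.symm) hW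
  obtain ⟨ℓ, hℓ⟩ := exists_ker_eq_of_finrank_add_one_eq (H := H₂) (by simp [hH₂])
  let f₀ : (Fin (e + 1) → F4) →ₗ[F4] (Fin (e + 1 + 1) → F4) :=
    LinearMap.vecCons 0 LinearMap.id
  let g : (Fin (e + 1) → F4) →ₗ[F4] (Fin (e + 1 + 1) → F4) := LinearMap.vecCons ℓ LinearMap.id
  let f := f₀ ∘ₗ φ.toLinearMap
  have hf₀ : ∀ v, f₀ v = Fin.cons 0 v := fun _ => rfl
  have hg₀ : ∀ v, g v = Fin.cons (ℓ v) v := fun _ => rfl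
  have hf₀i : Function.Injective f₀ := fun v w h => by
    rw [hf₀, hf₀] at h
    exact (Fin.cons_inj.1 h).2
  have hg : Function.Injective g := fun v w h => by
    rw [hg₀, hg₀] at h
    exact (Fin.cons_inj.1 h).2
  have hf : Function.Injective f := hf₀i.comp φ.injective
  have hcf : (LinearMap.range f).comap g = H₂ := by
    rw [← hℓ]
    ext v
    constructor
    · rintro ⟨w, hw⟩
      have hw' : (Fin.cons 0 (φ w) : Fin (e + 1 + 1) → F4) = Fin.cons (ℓ v) v := hw
      exact (Fin.cons_inj.1 hw').1.symm
    · intro hv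
      refine ⟨φ.symm v, ?_⟩
      change f₀ (φ (φ.symm v)) = g v
      rw [φ.apply_symm_apply, hf₀, hg₀, LinearMap.mem_ker.1 hv]
  have hcg : (LinearMap.range g).comap f = H₁ := by
    ext v
    have hv : φ v ∈ H₂ ↔ v ∈ H₁ := by
      rw [← hφH]
      simp
    rw [← hv, ← hℓ, LinearMap.mem_ker]
    constructor
    · rintro ⟨w, hw⟩
      have hw' : (Fin.cons (ℓ w) w : Fin (e + 1 + 1) → F4) = Fin.cons 0 (φ v) := hw
      obtain ⟨h0, rfl⟩ := Fin.cons_inj.1 hw'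
      exact h0
    · intro h0
      refine ⟨φ v, ?_⟩
      change g (φ v) = f₀ (φ v)
      rw [hf₀, hg₀, h0]
  have hgf : ∀ v ∈ H₂, g v = f₀ v := fun v hv => by
    rw [← hℓ, LinearMap.mem_ker] at hv
    rw [hf₀, hg₀, hv]
  have hmapW : W₁.map f = W₂.map g := by
    rw [Submodule.map_comp, hφW]
    ext x
    simp only [Submodule.mem_map]
    exact exists_congr fun v => and_congr_right fun hv => by rw [hgf v (hW₂ hv)]
  have himg : ∀ {h : (Fin (e + 1) → F4) →ₗ[F4] (Fin (e + 1 + 1) → F4)} (hh : Function.Injective h)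
      (D : Set (PGPoint e)) (R : Submodule F4 (Fin (e + 1 + 1) → F4)),
      Projectivization.map h hh '' D ∩ pointsIn R =
        Projectivization.map h hh '' (D ∩ pointsIn (R.comap h)) := fun hh D R => by
    rw [← Set.image_inter_preimage]
    congr 2
    ext p
    exact map_mem_pointsIn hh
  have hfW : Projectivization.map f hf '' D₁ ∩ pointsIn (LinearMap.range g) =
      pointsIn (W₂.map g) := by
    rw [himg, hcg, hD₁, image_map_pointsIn, hmapW]
  have hgW : Projectivization.map g hg '' D₂ ∩ pointsIn (LinearMap.range f) =
      pointsIn (W₂.map g) := by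
    rw [himg, hcf, hD₂, image_map_pointsIn]
  refine ⟨_, h₁.union_image_map h₂ hf hg (hfW.trans hgW.symm), ?_⟩
  have hinter : Projectivization.map f hf '' D₁ ∩ Projectivization.map g hg '' D₂ =
      pointsIn (W₂.map g) := by
    apply Set.Subset.antisymm
    · rw [← hfW]
      exact Set.inter_subset_inter_right _ (image_map_subset_pointsIn_range hg D₂)
    · exact Set.subset_inter (hfW ▸ Set.inter_subset_left) (hgW ▸ Set.inter_subset_left)
  rw [← Set.ncard_image_of_injective (pointsIn W₂) (Projectivization.map_injective g hg),
    image_map_pointsIn, ← hinter, Set.ncard_union_add_ncard_inter,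
    Set.ncard_image_of_injective _ (Projectivization.map_injective f hf),
    Set.ncard_image_of_injective _ (Projectivization.map_injective g hg)]

/-- The gluing lemma.  If `PG_{d-1}(4)` admits legal truncations removing `n₁` and `n₂`
points, each leaving some hyperplane untouched, then `PG_d(4)` admits a legal truncation
removing `n₁ + n₂` points.  Moreover, if `PG_{d-1}(4)` admits legal truncations removing
`n₁` and `n₂` points, each leaving some hyperplane whose removed points are exactly a copy
of `PG_i(4)`, then `PG_d(4)` admits a legal truncation removing `n₁ + n₂ - [i]₄` points. -/
theorem statement11 (d : ℕ) (hd : 1 ≤ d) :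
    (∀ n₁ n₂ : ℕ,
      (∃ D : Set (PGPoint (d - 1)), LegalTrunc D ∧ D.ncard = n₁ ∧
        ∃ H : Submodule F4 (Fin (d - 1 + 1) → F4),
          Module.finrank F4 H = d - 1 ∧ D ∩ pointsIn H = ∅) →
      (∃ D : Set (PGPoint (d - 1)), LegalTrunc D ∧ D.ncard = n₂ ∧
        ∃ H : Submodule F4 (Fin (d - 1 + 1) → F4),
          Module.finrank F4 H = d - 1 ∧ D ∩ pointsIn H = ∅) →
      ∃ D : Set (PGPoint d), LegalTrunc D ∧ D.ncard = n₁ + n₂) ∧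
    ∀ i n₁ n₂ : ℕ, n₁ ∈ TT (d - 1) i → n₂ ∈ TT (d - 1) i →
      ∃ D : Set (PGPoint d), LegalTrunc D ∧ D.ncard = n₁ + n₂ - bracket4 i := by
  obtain ⟨e, rfl⟩ := Nat.exists_eq_add_of_le' hd
  constructor
  · rintro _ _ ⟨D₁, h₁, rfl, H₁, hH₁, hD₁⟩ ⟨D₂, h₂, rfl, H₂, hH₂, hD₂⟩
    obtain ⟨D, hD, hcard⟩ := exists_legalTrunc_glue h₁ h₂ hH₁ hH₂ rfl bot_le bot_le
      (hD₁.trans pointsIn_bot.symm) (hD₂.trans pointsIn_bot.symm)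
    rw [pointsIn_bot, Set.ncard_empty, add_zero] at hcard
    exact ⟨D, hD, hcard⟩
  · rintro i _ _ ⟨D₁, h₁, rfl, H₁, W₁, hH₁, hW₁, hle₁, hD₁⟩
      ⟨D₂, h₂, rfl, H₂, W₂, hH₂, hW₂, hle₂, hD₂⟩
    obtain ⟨D, hD, hcard⟩ := exists_legalTrunc_glue h₁ h₂ hH₁ hH₂ (hW₁.trans hW₂.symm)
      hle₁ hle₂ hD₁ hD₂
    rw [ncard_pointsIn, hW₂] at hcard
    exact ⟨D, hD, Nat.eq_sub_of_add_eq hcard⟩
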